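/- Let R be a commutative Noetherian catenary ring of finite Krull dimension. Form the Beilinson–Parshin adelic cochain complex: for s ≥ 0, C^s is the product over all flags p0 > p1 > ⋯ > ps in the Balmer order (strictly increasing chains of prime ideals p0 ⊊ p1 ⊊ ⋯ ⊊ ps) of the nested modules A_{p0}( ∏_{p1} A_{p1}( ⋯ ∏_{ps} A_{ps}( R ) ⋯ )), where A_p N = Λ_p(L_p N) is localization at p followed by p-adic completion, with differential δ = Σ (−1)^i δ_i given for i ≤ s by inserting the natural map N → A_{p_i}N at the i-th spot and for i = s+1 by the identity coefficient map followed by the natural map into A_{p_{s+1}}. Then H^0 of this complex is isomorphic to R via the canonical augmentation, and H^s = 0 for all s > 0. -/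

import Mathlib

section AdelicMachinery

variable (R : Type) [CommRing R]

/-- The Beilinson–Parshin functor `A_p = Λ_p ∘ L_p` on objects:
`A_p N = (N_p)^∧_p`. -/
noncomputable abbrev BP (p : PrimeSpectrum R) (M : Type) [AddCommGroup M] [Module R M] :
    Type :=
  AdicCompletion p.asIdeal (LocalizedModule p.asIdeal.primeCompl M)

/-- The natural map `N → A_p N = Λ_p(L_p N)`. -/
noncomputable def bpUnit (p : PrimeSpectrum R) (M : Type) [AddCommGroup M] [Module R M] :
    M →ₗ[R] BP R p M :=
  (AdicCompletion.of p.asIdeal (LocalizedModule p.asIdeal.primeCompl M)) ∘ₗ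
    LocalizedModule.mkLinearMap p.asIdeal.primeCompl M

/-- The functorial action of `A_p = Λ_p ∘ L_p` on maps (as `R`-linear maps). -/
noncomputable def bpMap (p : PrimeSpectrum R) {M N : Type} [AddCommGroup M] [Module R M]
    [AddCommGroup N] [Module R N] (f : M →ₗ[R] N) : BP R p M →ₗ[R] BP R p N :=
  (AdicCompletion.map p.asIdeal
      (IsLocalizedModule.map p.asIdeal.primeCompl
        (LocalizedModule.mkLinearMap p.asIdeal.primeCompl M)
        (LocalizedModule.mkLinearMap p.asIdeal.primeCompl N) f)).restrictScalars R

/-- The nested Beilinson–Parshin adelic modules over flags in the Balmer order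
(reverse inclusion): `G s p = A_p (∏_{p₁ ⊋ p} A_{p₁} ( ⋯ ∏_{p_s} A_{p_s}(R) ⋯ ))`,
with `A_p N = Λ_p(L_p N)`. -/
noncomputable def G : ℕ → PrimeSpectrum R → ModuleCat R
  | 0, p => ModuleCat.of R (BP R p R)
  | k + 1, p => ModuleCat.of R (BP R p (∀ q : {q : PrimeSpectrum R // p < q}, G k q.1))

/-- Insertion of a new flag entry immediately below `p`, via the units `N → A_q N`. -/
noncomputable def phi (k : ℕ) (p : PrimeSpectrum R) :
    (∀ q : {q : PrimeSpectrum R // p < q}, G R k q.1) →ₗ[R]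
      (∀ q : {q : PrimeSpectrum R // p < q}, G R (k + 1) q.1) :=
  LinearMap.pi fun q' =>
    (bpUnit R q'.1 (∀ r : {r : PrimeSpectrum R // q'.1 < r}, G R k r.1)) ∘ₗ
      (LinearMap.pi fun r : {r : PrimeSpectrum R // q'.1 < r} =>
        LinearMap.proj (⟨r.1, lt_trans q'.2 r.2⟩ : {q : PrimeSpectrum R // p < q}))

/-- Insertion below the innermost flag entry: the (identity) coefficient map of the
constant system `R` followed by the units `R → A_q R`. -/
noncomputable def psi (p : PrimeSpectrum R) :
    R →ₗ[R] (∀ q : {q : PrimeSpectrum R // p < q}, G R 0 q.1) :=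
  LinearMap.pi fun q => bpUnit R q.1 R

/-- `ins i s p : G s p → G (s+1) p` inserts a new flag entry at depth `i+1` below `p`. -/
noncomputable def ins : ℕ → (s : ℕ) → (p : PrimeSpectrum R) → (G R s p →ₗ[R] G R (s + 1) p)
  | 0, 0, p => bpMap R p (psi R p)
  | 0, k + 1, p => bpMap R p (phi R k p)
  | _ + 1, 0, p => bpMap R p (psi R p)
  | i + 1, k + 1, p => bpMap R p
      (LinearMap.pi fun q : {q : PrimeSpectrum R // p < q} =>
        (ins i k q.1) ∘ₗ LinearMap.proj q)

/-- The `i`-th face map `δᵢ : C^s → C^{s+1}` of the Beilinson–Parshin adelic cochain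
complex. -/
noncomputable def delta (s i : ℕ) :
    (∀ p : PrimeSpectrum R, G R s p) →ₗ[R] (∀ p : PrimeSpectrum R, G R (s + 1) p) :=
  if i = 0 then
    LinearMap.pi fun p =>
      (bpUnit R p (∀ q : {q : PrimeSpectrum R // p < q}, G R s q.1)) ∘ₗ
        (LinearMap.pi fun q : {q : PrimeSpectrum R // p < q} => LinearMap.proj q.1)
  else
    LinearMap.pi fun p => (ins R (i - 1) s p) ∘ₗ LinearMap.proj p

/-- The total differential `δ = Σᵢ (-1)ⁱ δᵢ`. -/
noncomputable def adelicD (s : ℕ) :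
    (∀ p : PrimeSpectrum R, G R s p) →ₗ[R] (∀ p : PrimeSpectrum R, G R (s + 1) p) :=
  ∑ i ∈ Finset.range (s + 2), ((-1 : ℤ) ^ i) • delta R s i

/-- The canonical augmentation `R → C⁰ = ∏_p A_p R = ∏_p (R_p)^∧_p`. -/
noncomputable def adelicAug : R →ₗ[R] (∀ p : PrimeSpectrum R, G R 0 p) :=
  LinearMap.pi fun p => bpUnit R p R

/-- A partial order is catenary if any two saturated chains with the same endpoints
have the same length. -/
def IsCatenaryOrder (α : Type*) [PartialOrder α] : Prop :=
  ∀ c d : LTSeries α, c.head = d.head → c.last = d.last →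
    (∀ i : Fin c.length, c.toFun i.castSucc ⋖ c.toFun i.succ) →
    (∀ i : Fin d.length, d.toFun i.castSucc ⋖ d.toFun i.succ) →
    c.length = d.length

end AdelicMachinery

/-- The colon criterion `(I N : x) = (I : x) N` for all ideals `I` and elements `x`; over a
Noetherian ring this is equivalent to flatness of `N`. -/
def IsColonFlat (R N : Type) [CommRing R] [AddCommGroup N] [Module R N] : Prop :=
  ∀ (I : Ideal R) (x : R) (n : N), x • n ∈ I • (⊤ : Submodule R N) →
    n ∈ I.colon {x} • (⊤ : Submodule R N)

section ColonFlat

variable {R : Type} [CommRing R] {N : Type} [AddCommGroup N] [Module R N]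

theorem mem_span_range_smul_top_iff {k : ℕ} (g : Fin k → R) (n : N) :
    n ∈ Ideal.span (Set.range g) • (⊤ : Submodule R N) ↔ ∃ m : Fin k → N, n = ∑ i, g i • m i := by
  constructor
  · intro h
    refine Submodule.smul_induction_on h ?_ ?_
    · intro r hr m _
      obtain ⟨c, rfl⟩ := Ideal.mem_span_range_iff_exists_fun.1 hr
      refine ⟨fun i => c i • m, ?_⟩
      rw [Finset.sum_smul]
      exact Finset.sum_congr rfl fun i _ => by rw [smul_smul, mul_comm]
    · rintro _ _ ⟨m, rfl⟩ ⟨m', rfl⟩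
      exact ⟨fun i => m i + m' i, by simp [Finset.sum_add_distrib]⟩
  · rintro ⟨m, rfl⟩
    exact Submodule.sum_mem _ fun i _ =>
      Submodule.smul_mem_smul (Ideal.subset_span ⟨i, rfl⟩) trivial

theorem Ideal.exists_span_range_eq [IsNoetherianRing R] (I : Ideal R) :
    ∃ (k : ℕ) (g : Fin k → R), Ideal.span (Set.range g) = I :=
  Submodule.fg_iff_exists_fin_generating_family.1 (IsNoetherian.noetherian I)

theorem mem_smul_top_pi [IsNoetherianRing R] {ι : Type} {M : ι → Type}
    [∀ i, AddCommGroup (M i)] [∀ i, Module R (M i)] (I : Ideal R) (v : ∀ i, M i)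
    (hv : ∀ i, v i ∈ I • (⊤ : Submodule R (M i))) : v ∈ I • (⊤ : Submodule R (∀ i, M i)) := by
  obtain ⟨k, g, rfl⟩ := I.exists_span_range_eq
  choose m hm using fun i => (mem_span_range_smul_top_iff g (v i)).1 (hv i)
  refine (mem_span_range_smul_top_iff g v).2 ⟨fun j i => m i j, ?_⟩
  ext i
  simp [hm i]

theorem mem_smul_top_mono {I J : Ideal R} (h : I ≤ J) {n : N}
    (hn : n ∈ I • (⊤ : Submodule R N)) : n ∈ J • (⊤ : Submodule R N) :=
  Submodule.smul_mono h le_rfl hn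

theorem map_mem_smul_top {N' : Type} [AddCommGroup N'] [Module R N'] (f : N →ₗ[R] N')
    {I : Ideal R} {n : N} (hn : n ∈ I • (⊤ : Submodule R N)) :
    f n ∈ I • (⊤ : Submodule R N') := by
  have := Submodule.mem_map_of_mem (f := f) hn
  rw [Submodule.map_smul''] at this
  exact Submodule.smul_mono le_rfl le_top this

theorem isColonFlat_self : IsColonFlat R R := by
  intro I x n h
  simp only [smul_eq_mul, Ideal.mul_top] at h ⊢
  rw [Submodule.mem_colon_singleton, smul_eq_mul, mul_comm]
  exact h

theorem isColonFlat_pi [IsNoetherianRing R] {ι : Type} {M : ι → Type}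
    [∀ i, AddCommGroup (M i)] [∀ i, Module R (M i)] (h : ∀ i, IsColonFlat R (M i)) :
    IsColonFlat R (∀ i, M i) := fun I x v hv =>
  mem_smul_top_pi _ _ fun i => h i I x (v i) (map_mem_smul_top (LinearMap.proj i) hv)

theorem exists_smul_eq_of_mem_smul_top_localizedModule (S : Submonoid R) {I : Ideal R}
    {z : LocalizedModule S N} (hz : z ∈ I • (⊤ : Submodule R (LocalizedModule S N))) :
    ∃ s ∈ S, ∃ n ∈ I • (⊤ : Submodule R N), s • z = LocalizedModule.mkLinearMap S N n := by
  refine Submodule.smul_induction_on hz ?_ ?_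
  · intro r hr z _
    obtain ⟨⟨n, s⟩, hs⟩ := IsLocalizedModule.surj S (LocalizedModule.mkLinearMap S N) z
    refine ⟨s, s.2, r • n, Submodule.smul_mem_smul hr trivial, ?_⟩
    rw [map_smul, ← hs, smul_comm]
    rfl
  · rintro z z' ⟨s, hs, n, hn, h⟩ ⟨s', hs', n', hn', h'⟩
    refine ⟨s' * s, S.mul_mem hs' hs, s' • n + s • n',
      Submodule.add_mem _ (Submodule.smul_mem _ _ hn) (Submodule.smul_mem _ _ hn'), ?_⟩
    rw [map_add, map_smul, map_smul, ← h, ← h', smul_add, smul_smul, smul_smul, mul_comm s s']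

theorem exists_smul_mem_of_mkLinearMap_mem (S : Submonoid R) {I : Ideal R} {n : N}
    (hn : LocalizedModule.mkLinearMap S N n ∈ I • (⊤ : Submodule R (LocalizedModule S N))) :
    ∃ s ∈ S, s • n ∈ I • (⊤ : Submodule R N) := by
  obtain ⟨s, hs, m, hm, h⟩ := exists_smul_eq_of_mem_smul_top_localizedModule S hn
  rw [← map_smul] at h
  obtain ⟨t, ht⟩ := (IsLocalizedModule.eq_iff_exists S (LocalizedModule.mkLinearMap S N)).1 h
  refine ⟨t * s, S.mul_mem t.2 hs, ?_⟩
  have : ((t : R) * s) • n = (t : R) • m := by rw [mul_smul]; exact ht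
  rw [this]
  exact Submodule.smul_mem _ _ hm

theorem mem_of_smul_mem_localizedModule {S : Submonoid R} {I : Ideal R}
    {z : LocalizedModule S N} {s : R} (hs : s ∈ S)
    (hz : s • z ∈ I • (⊤ : Submodule R (LocalizedModule S N))) :
    z ∈ I • (⊤ : Submodule R (LocalizedModule S N)) := by
  obtain ⟨u, hu⟩ := IsLocalizedModule.map_units (LocalizedModule.mkLinearMap S N) ⟨s, hs⟩
  have h1 := map_mem_smul_top ((u⁻¹ : (Module.End R (LocalizedModule S N))ˣ).val) hz
  have h2 : (u⁻¹.val) (s • z) = z := by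
    have : s • z = u.val z := by rw [hu]; rfl
    rw [this, ← Module.End.mul_apply, Units.inv_mul]
    rfl
  rwa [h2] at h1

theorem IsColonFlat.localizedModule (hN : IsColonFlat R N) (S : Submonoid R) :
    IsColonFlat R (LocalizedModule S N) := by
  intro I x z hz
  obtain ⟨⟨n, s⟩, hs⟩ := IsLocalizedModule.surj S (LocalizedModule.mkLinearMap S N) z
  have hs' : (s : R) • z = LocalizedModule.mkLinearMap S N n := hs
  have h1 : LocalizedModule.mkLinearMap S N (x • n) ∈
      I • (⊤ : Submodule R (LocalizedModule S N)) := by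
    rw [map_smul, ← hs', smul_comm]
    exact Submodule.smul_mem _ _ hz
  obtain ⟨t, ht, h2⟩ := exists_smul_mem_of_mkLinearMap_mem S h1
  rw [smul_comm] at h2
  have h3 := map_mem_smul_top (LocalizedModule.mkLinearMap S N) (hN I x _ h2)
  rw [map_smul, ← hs'] at h3
  exact mem_of_smul_mem_localizedModule s.2 (mem_of_smul_mem_localizedModule ht h3)

theorem Ideal.span_singleton_mul_colon_le (I : Ideal R) (x : R) :
    Ideal.span {x} * I.colon {x} ≤ I := by
  rw [Ideal.span_singleton_mul_le_iff]
  intro r hr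
  rw [mul_comm]
  exact Submodule.mem_colon_singleton.1 hr

theorem IsColonFlat.inf_span_singleton_smul_top_le (hN : IsColonFlat R N) (I : Ideal R) (x : R) :
    (I • ⊤ ⊓ Ideal.span {x} • ⊤ : Submodule R N) ≤ (I ⊓ Ideal.span {x}) • (⊤ : Submodule R N) := by
  intro n hn
  obtain ⟨hI, hx⟩ := Submodule.mem_inf.1 hn
  rw [Submodule.ideal_span_singleton_smul, Submodule.mem_smul_pointwise_iff_exists] at hx
  obtain ⟨m, -, rfl⟩ := hx
  have h1 := Submodule.smul_mem_smul (Ideal.mem_span_singleton_self x) (hN I x m hI)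
  rw [← mul_smul] at h1
  exact mem_smul_top_mono (le_inf (I.span_singleton_mul_colon_le x) Ideal.mul_le_left) h1

theorem IsColonFlat.inf_smul_top_le [IsNoetherianRing R] (hN : IsColonFlat R N)
    (I J : Ideal R) :
    (I • ⊤ ⊓ J • ⊤ : Submodule R N) ≤ (I ⊓ J) • (⊤ : Submodule R N) := by
  induction J, IsNoetherian.noetherian J using Submodule.fg_induction generalizing I with
  | singleton x => exact hN.inf_span_singleton_smul_top_le I x
  | sup J₁ J₂ _ _ h₁ h₂ =>
    intro n hn
    obtain ⟨hI, hJ⟩ := Submodule.mem_inf.1 hn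
    rw [Submodule.sup_smul] at hJ
    obtain ⟨j₁, hj₁, j₂, hj₂, rfl⟩ := Submodule.mem_sup.1 hJ
    have h3 : j₂ ∈ (I ⊔ J₁) • (⊤ : Submodule R N) := by
      rw [Submodule.sup_smul]
      have := Submodule.sub_mem _ (Submodule.mem_sup_left (T := J₁ • (⊤ : Submodule R N)) hI)
        (Submodule.mem_sup_right (S := I • (⊤ : Submodule R N)) hj₁)
      simpa using this
    have h4 := h₂ (I ⊔ J₁) (Submodule.mem_inf.2 ⟨h3, hj₂⟩)
    have h5 : (I ⊔ J₁) ⊓ J₂ ≤ (I ⊓ (J₁ ⊔ J₂)) ⊔ J₁ := by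
      rintro _ ⟨h, h'⟩
      obtain ⟨a, ha, b, hb, rfl⟩ := Submodule.mem_sup.1 h
      refine Submodule.add_mem_sup ⟨ha, ?_⟩ hb
      have := Submodule.sub_mem _ (Submodule.mem_sup_right (S := J₁) h')
        (Submodule.mem_sup_left (T := J₂) hb)
      simpa using this
    have h6 := mem_smul_top_mono h5 h4
    rw [Submodule.sup_smul] at h6
    obtain ⟨a, ha, b, hb, rfl⟩ := Submodule.mem_sup.1 h6
    have h7 : j₁ + b ∈ I • (⊤ : Submodule R N) := by
      have := Submodule.sub_mem _ hI
        (mem_smul_top_mono inf_le_left ha)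
      rwa [show j₁ + (a + b) - a = j₁ + b by abel] at this
    have h8 := h₁ I (Submodule.mem_inf.2 ⟨h7, Submodule.add_mem _ hj₁ hb⟩)
    have h9 := Submodule.smul_mono_left (N := (⊤ : Submodule R N))
      (inf_le_inf_left I (le_sup_left : J₁ ≤ J₁ ⊔ J₂)) h8
    rw [show j₁ + (a + b) = a + (j₁ + b) by abel]
    exact Submodule.add_mem _ ha h9

theorem IsColonFlat.exists_artinRees [IsNoetherianRing R] (hN : IsColonFlat R N)
    (I J : Ideal R) : ∃ c : ℕ, ∀ n : ℕ,
      (I ^ (n + c) • ⊤ ⊓ J • ⊤ : Submodule R N) ≤ I ^ n • (J • (⊤ : Submodule R N)) := by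
  obtain ⟨c, hc⟩ := I.exists_pow_inf_eq_pow_smul (M := R) J
  refine ⟨c, fun n => (hN.inf_smul_top_le _ _).trans ?_⟩
  rw [← mul_smul]
  refine Submodule.smul_mono_left ?_
  have := hc (n + c) (Nat.le_add_left c n)
  rw [Nat.add_sub_cancel, smul_eq_mul, Ideal.mul_top] at this
  rw [this]
  exact Ideal.mul_mono_right inf_le_right

theorem AdicCompletion.map_sum_smul_proj (I : Ideal R) {k : ℕ} (g : Fin k → R)
    (w : AdicCompletion I (Fin k → N)) :
    AdicCompletion.map I (∑ i, g i • (LinearMap.proj i : (Fin k → N) →ₗ[R] N)) w =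
      ∑ i, g i • AdicCompletion.map I (LinearMap.proj i) w := by
  induction w using AdicCompletion.induction_on with
  | _ a =>
  ext n
  simp only [AdicCompletion.map_mk, AdicCompletion.val_sum_apply, AdicCompletion.val_smul_apply]
  simp

theorem AdicCompletion.mem_smul_top_of_forall_val [IsNoetherianRing R] (hN : IsColonFlat R N)
    (I J : Ideal R) (v : AdicCompletion I N)
    (hv : ∀ n, ∃ m ∈ J • (⊤ : Submodule R N), v.val n = Submodule.Quotient.mk m) :
    v ∈ J • (⊤ : Submodule R (AdicCompletion I N)) := by
  obtain ⟨k, g, hg⟩ := J.exists_span_range_eq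
  let f : (Fin k → N) →ₗ[R] N := ∑ i, g i • LinearMap.proj i
  have hf : LinearMap.range f = J • ⊤ := by
    ext n
    rw [← hg, mem_span_range_smul_top_iff]
    simp [f, eq_comm]
  obtain ⟨c, hc⟩ := hN.exists_artinRees I J
  choose m hm hvm using hv
  let a : ℕ → LinearMap.range f := fun n => ⟨m (n + c), hf ▸ hm _⟩
  have ha : ∀ n, a n ≡ a (n + 1) [SMOD (I ^ n • ⊤ : Submodule R (LinearMap.range f))] := by
    intro n
    rw [SModEq.sub_mem]
    have h1 : m (n + c) - m (n + 1 + c) ∈ I ^ (n + c) • (⊤ : Submodule R N) := by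
      rw [← Submodule.Quotient.eq, ← hvm, ← v.property (show n + c ≤ n + 1 + c by omega), hvm]
      rfl
    have h2 := hc n (Submodule.mem_inf.2 ⟨h1, Submodule.sub_mem _ (hm _) (hm _)⟩)
    rw [← hf, ← Submodule.range_subtype (LinearMap.range f), ← Submodule.map_top,
      ← Submodule.map_smul''] at h2
    obtain ⟨z, hz, hz'⟩ := h2
    rwa [show a n - a (n + 1) = z from Subtype.ext hz'.symm]
  obtain ⟨w, hw⟩ := AdicCompletion.map_surjective I f.surjective_rangeRestrict
    (AdicCompletion.mk I _ (AdicCompletion.AdicCauchySequence.mk I _ a ha))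
  have h3 : v = AdicCompletion.map I f w := by
    have hf' : f = (LinearMap.range f).subtype ∘ₗ f.rangeRestrict := rfl
    conv_rhs => rw [hf', ← AdicCompletion.map_comp_apply, hw, AdicCompletion.map_mk]
    ext n
    rw [← v.property (Nat.le_add_right n c), hvm]
    rfl
  rw [h3, AdicCompletion.map_sum_smul_proj, ← hg]
  exact (mem_span_range_smul_top_iff g _).2 ⟨_, rfl⟩

theorem Ideal.exists_colon_sup_pow_le [IsNoetherianRing R] (I J : Ideal R) (x : R) :
    ∃ c : ℕ, ∀ n : ℕ, (J ⊔ I ^ (n + c)).colon {x} ≤ J.colon {x} ⊔ I ^ n := by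
  obtain ⟨c, hc⟩ := isColonFlat_self.exists_artinRees I (J ⊔ Ideal.span {x})
  refine ⟨c, fun n r hr => ?_⟩
  rw [Submodule.mem_colon_singleton, smul_eq_mul] at hr
  obtain ⟨j, hj, y, hy, hjy⟩ := Submodule.mem_sup.1 hr
  have h1 : y ∈ J ⊔ Ideal.span {x} := by
    rw [show y = r * x - j by rw [← hjy]; ring]
    exact Submodule.sub_mem _
      (Submodule.mem_sup_right (Ideal.mul_mem_left _ _ (Ideal.mem_span_singleton_self x)))
      (Submodule.mem_sup_left hj)
  have h2 : y ∈ I ^ n * (J ⊔ Ideal.span {x}) := by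
    have := hc n
    simp only [smul_eq_mul, Ideal.mul_top] at this
    exact this (Submodule.mem_inf.2 ⟨hy, h1⟩)
  rw [Ideal.mul_sup] at h2
  obtain ⟨j', hj', z, hz, hjz⟩ := Submodule.mem_sup.1 h2
  obtain ⟨i, hi, rfl⟩ := Ideal.mem_mul_span_singleton.1 hz
  rw [← sub_add_cancel r i]
  refine Submodule.add_mem_sup ?_ hi
  rw [Submodule.mem_colon_singleton, smul_eq_mul,
    show (r - i) * x = j + j' by rw [sub_mul, ← hjy, ← hjz]; ring]
  exact J.add_mem hj (Ideal.mul_le_right hj')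

theorem IsColonFlat.adicCompletion [IsNoetherianRing R] (hN : IsColonFlat R N) (I : Ideal R) :
    IsColonFlat R (AdicCompletion I N) := by
  intro J x v hv
  refine AdicCompletion.mem_smul_top_of_forall_val hN I _ v fun n => ?_
  obtain ⟨c, hc⟩ := I.exists_colon_sup_pow_le J x
  obtain ⟨y, hy⟩ := Submodule.Quotient.mk_surjective _ (v.val (n + c))
  have h1 := map_mem_smul_top (AdicCompletion.eval I N (n + c)) hv
  rw [map_smul, AdicCompletion.eval_apply, ← hy, ← Submodule.range_mkQ, ← Submodule.map_top,
    ← Submodule.map_smul''] at h1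
  obtain ⟨z, hz, hzy⟩ := h1
  rw [← Submodule.mkQ_apply, ← map_smul, ← sub_eq_zero, ← map_sub, Submodule.mkQ_apply,
    Submodule.Quotient.mk_eq_zero] at hzy
  have h2 : x • y ∈ (J ⊔ I ^ (n + c)) • (⊤ : Submodule R N) := by
    rw [Submodule.sup_smul, ← sub_sub_cancel z (x • y)]
    exact Submodule.sub_mem _ (Submodule.mem_sup_left hz) (Submodule.mem_sup_right hzy)
  have h3 := mem_smul_top_mono (hc n) (hN _ x y h2)
  rw [Submodule.sup_smul] at h3
  obtain ⟨m, hm, w, hw, rfl⟩ := Submodule.mem_sup.1 h3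
  refine ⟨m, hm, ?_⟩
  rw [← v.property (Nat.le_add_right n c), ← hy]
  refine (Submodule.Quotient.eq _).2 ?_
  simpa using hw

end ColonFlat

/-- Noetherian induction on `I`: a complex of flat modules is exact modulo every ideal `I` as soon
as, for every prime `P`, its cohomology modulo `P` is torsion over `R ⧸ P`. -/
theorem exact_mod_ideal_of_torsion_mod_prime {R : Type} [CommRing R] [IsNoetherianRing R]
    {K : ℕ → Type} [∀ s, AddCommGroup (K s)] [∀ s, Module R (K s)]
    (d : ∀ s, K s →ₗ[R] K (s + 1)) (hd : ∀ s k, d (s + 1) (d s k) = 0)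
    (h0 : Subsingleton (K 0)) (hK : ∀ s, IsColonFlat R (K s))
    (hP : ∀ (P : PrimeSpectrum R) (s : ℕ) (k : K (s + 1)),
      d (s + 1) k ∈ P.asIdeal • (⊤ : Submodule R (K (s + 2))) →
      ∃ x ∉ P.asIdeal, ∃ k' : K s, x • k - d s k' ∈ P.asIdeal • (⊤ : Submodule R (K (s + 1))))
    (I : Ideal R) : ∀ (s : ℕ) (k : K (s + 1)),
      d (s + 1) k ∈ I • (⊤ : Submodule R (K (s + 2))) →
      ∃ k' : K s, k - d s k' ∈ I • (⊤ : Submodule R (K (s + 1))) := by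
  induction I using IsNoetherian.induction with
  | _ I ih =>
  have exists_decomp : ∀ (x : R), x ∉ I → ∀ (s : ℕ) (k : K (s + 1)),
      d (s + 1) k ∈ (I ⊔ Ideal.span {x}) • (⊤ : Submodule R (K (s + 2))) →
      ∃ (k' : K s) (i m : K (s + 1)), i ∈ I • (⊤ : Submodule R (K (s + 1))) ∧
        k = d s k' + i + x • m := by
    intro x hx s k hk
    have hlt : I < I ⊔ Ideal.span {x} := lt_of_le_of_ne le_sup_left fun h =>
      hx (h ▸ Submodule.mem_sup_right (Ideal.mem_span_singleton_self x))
    obtain ⟨k', hk'⟩ := ih _ hlt s k hk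
    rw [Submodule.sup_smul, Submodule.ideal_span_singleton_smul] at hk'
    obtain ⟨i, hi, z, hz, hiz⟩ := Submodule.mem_sup.1 hk'
    obtain ⟨m, -, rfl⟩ := Submodule.mem_smul_pointwise_iff_exists _ _ _ |>.1 hz
    exact ⟨k', i, m, hi, by rw [add_assoc, hiz]; abel⟩
  by_cases htop : I = ⊤
  · intro s k _
    exact ⟨0, by rw [htop, Submodule.top_smul]; trivial⟩
  by_cases hI : Ideal.IsPrime I
  · intro s k hk
    obtain ⟨x, hx, k', hxk⟩ := hP ⟨I, hI⟩ s k hk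
    have hcolon : ∀ z : K (s + 1), x • z ∈ I • (⊤ : Submodule R (K (s + 1))) →
        z ∈ I • (⊤ : Submodule R (K (s + 1))) := fun z hz =>
      mem_smul_top_mono
        (fun r hr => (hI.mem_or_mem (Submodule.mem_colon_singleton.1 hr)).resolve_right hx)
        (hK _ I x z hz)
    obtain _ | s := s
    · refine ⟨0, hcolon _ ?_⟩
      rw [Subsingleton.elim k' 0] at hxk
      simpa using hxk
    have hk' : d (s + 1) k' ∈ (I ⊔ Ideal.span {x}) • (⊤ : Submodule R (K (s + 2))) := by
      have h1 : x • k ∈ (I ⊔ Ideal.span {x}) • (⊤ : Submodule R (K (s + 2))) :=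
        Submodule.smul_mem_smul (Submodule.mem_sup_right (Ideal.mem_span_singleton_self x)) trivial
      have h2 := Submodule.sub_mem _ h1 (mem_smul_top_mono le_sup_left hxk)
      rwa [sub_sub_cancel] at h2
    obtain ⟨k'', i, m, hi, rfl⟩ := exists_decomp x hx s k' hk'
    refine ⟨m, hcolon _ ?_⟩
    have h3 := Submodule.add_mem _ hxk (map_mem_smul_top (d (s + 1)) hi)
    rw [map_add, map_add, hd, map_smul] at h3
    rw [smul_sub]
    convert h3 using 1
    abel
  · obtain ⟨x, y, hxy, hx, hy⟩ : ∃ x y, x * y ∈ I ∧ x ∉ I ∧ y ∉ I := by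
      simpa [Ideal.isPrime_iff, htop] using hI
    intro s k hk
    obtain ⟨k', i, m, hi, rfl⟩ := exists_decomp x hx s k (mem_smul_top_mono le_sup_left hk)
    rw [map_add, map_add, hd, zero_add, map_smul] at hk
    have h1 := Submodule.sub_mem _ hk (map_mem_smul_top (d (s + 1)) hi)
    rw [add_sub_cancel_left] at h1
    have hlt : I < I.colon {x} := lt_of_le_of_ne Ideal.le_colon fun h =>
      hy (by rw [h, Submodule.mem_colon_singleton, smul_eq_mul, mul_comm]; exact hxy)
    obtain ⟨m', hm'⟩ := ih _ hlt s m (hK _ I x _ h1)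
    have h2 := Submodule.smul_mem_smul (Ideal.mem_span_singleton_self x) hm'
    rw [← mul_smul] at h2
    have h4 := Submodule.add_mem _ hi (mem_smul_top_mono (Ideal.span_singleton_mul_colon_le I x) h2)
    refine ⟨k' + x • m', ?_⟩
    rw [smul_sub] at h4
    rw [map_add, map_smul]
    convert h4 using 1
    abel

section BeilinsonParshin

variable {R : Type} [CommRing R] {M N L : Type} [AddCommGroup M] [Module R M] [AddCommGroup N]
  [Module R N] [AddCommGroup L] [Module R L] (p : PrimeSpectrum R)

theorem bpMap_bpUnit (f : M →ₗ[R] N) (m : M) :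
    bpMap R p f (bpUnit R p M m) = bpUnit R p N (f m) := by
  simp only [bpMap, bpUnit, LinearMap.comp_apply, LinearMap.coe_restrictScalars,
    AdicCompletion.map_of, IsLocalizedModule.map_apply]

theorem bpMap_apply_val (f : M →ₗ[R] N) (a : AdicCompletion.AdicCauchySequence p.asIdeal
      (LocalizedModule p.asIdeal.primeCompl M)) (n : ℕ) :
    (bpMap R p f (AdicCompletion.mk _ _ a)).val n = Submodule.Quotient.mk
      (IsLocalizedModule.map p.asIdeal.primeCompl
        (LocalizedModule.mkLinearMap p.asIdeal.primeCompl M)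
        (LocalizedModule.mkLinearMap p.asIdeal.primeCompl N) f (a n)) :=
  rfl

theorem bpMap_add (f g : M →ₗ[R] N) : bpMap R p (f + g) = bpMap R p f + bpMap R p g := by
  refine LinearMap.ext fun v => AdicCompletion.ext fun n => ?_
  induction v using AdicCompletion.induction_on with
  | _ a =>
  rw [LinearMap.add_apply, AdicCompletion.val_add_apply]
  simp only [bpMap_apply_val, map_add, LinearMap.add_apply]
  rfl

theorem bpMap_comp (g : N →ₗ[R] L) (f : M →ₗ[R] N) :
    bpMap R p (g ∘ₗ f) = bpMap R p g ∘ₗ bpMap R p f := by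
  refine LinearMap.ext fun v => AdicCompletion.ext fun n => ?_
  induction v using AdicCompletion.induction_on with
  | _ a =>
  have := IsLocalizedModule.map_comp' p.asIdeal.primeCompl
    (LocalizedModule.mkLinearMap p.asIdeal.primeCompl M)
    (LocalizedModule.mkLinearMap p.asIdeal.primeCompl N)
    (LocalizedModule.mkLinearMap p.asIdeal.primeCompl L) f g
  rw [bpMap_apply_val, this]
  rfl

/-- `bpMap` as an additive homomorphism. -/
noncomputable def bpMapAddHom : (M →ₗ[R] N) →+ (BP R p M →ₗ[R] BP R p N) :=
  AddMonoidHom.mk' (bpMap R p) (bpMap_add p)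

theorem bpMap_zero : bpMap R p (0 : M →ₗ[R] N) = 0 :=
  map_zero (bpMapAddHom p)

theorem IsColonFlat.bp [IsNoetherianRing R] (hN : IsColonFlat R N) : IsColonFlat R (BP R p N) :=
  (hN.localizedModule _).adicCompletion _

theorem mem_smul_top_bp_of_not_le (P : Ideal R) (hP : ¬ P ≤ p.asIdeal) (v : BP R p N) :
    v ∈ P • (⊤ : Submodule R (BP R p N)) := by
  obtain ⟨x, hx, hxp⟩ := SetLike.not_le_iff_exists.1 hP
  have hu := IsLocalizedModule.map_units
    (LocalizedModule.mkLinearMap p.asIdeal.primeCompl N) (⟨x, hxp⟩ : p.asIdeal.primeCompl)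
  obtain ⟨w, rfl⟩ := AdicCompletion.map_surjective p.asIdeal
    ((Module.End.isUnit_iff _).1 hu).surjective v
  have : AdicCompletion.map p.asIdeal (algebraMap R (Module.End R
      (LocalizedModule p.asIdeal.primeCompl N)) x) w = x • w := by
    induction w using AdicCompletion.induction_on with
    | _ a => rfl
  rw [this]
  exact Submodule.smul_mem_smul hx trivial

theorem exists_smul_mem_of_bpUnit_mem {n : N}
    (hn : bpUnit R p N n ∈ p.asIdeal • (⊤ : Submodule R (BP R p N))) :
    ∃ x ∉ p.asIdeal, x • n ∈ p.asIdeal • (⊤ : Submodule R N) := by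
  have hn' : bpUnit R p N n ∈ p.asIdeal ^ 1 • (⊤ : Submodule R (BP R p N)) := by rwa [pow_one]
  have h := AdicCompletion.pow_smul_top_le_ker_eval p.asIdeal 1 hn'
  have h' := (Submodule.Quotient.mk_eq_zero _).1 h
  rw [pow_one] at h'
  exact exists_smul_mem_of_mkLinearMap_mem _ h'

theorem exists_smul_sub_bpUnit_mem [IsNoetherianRing R] (hN : IsColonFlat R N) (v : BP R p N) :
    ∃ x ∉ p.asIdeal, ∃ n : N,
      x • v - bpUnit R p N n ∈ p.asIdeal • (⊤ : Submodule R (BP R p N)) := by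
  obtain ⟨z, hz⟩ := Submodule.Quotient.mk_surjective _ (v.val 1)
  have h1 : v - AdicCompletion.of _ _ z ∈ p.asIdeal • (⊤ : Submodule R (BP R p N)) := by
    refine AdicCompletion.mem_smul_top_of_forall_val (hN.localizedModule _) _ _ _ fun n => ?_
    obtain _ | n := n
    · refine ⟨0, Submodule.zero_mem _, ?_⟩
      obtain ⟨y, hy⟩ := Submodule.Quotient.mk_surjective _
        ((v - AdicCompletion.of p.asIdeal _ z).val 0)
      rw [← hy]
      refine (Submodule.Quotient.eq _).2 ?_
      rw [pow_zero, Ideal.one_eq_top, Submodule.top_smul]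
      trivial
    · obtain ⟨y, hy⟩ := Submodule.Quotient.mk_surjective _ (v.val (n + 1))
      refine ⟨y - z, ?_, ?_⟩
      · have h2 := v.property (Nat.le_add_left 1 n)
        rw [← hz] at h2
        have h3 : (Submodule.Quotient.mk y : _ ⧸ (p.asIdeal ^ 1 • ⊤ :
            Submodule R (LocalizedModule p.asIdeal.primeCompl N))) = Submodule.Quotient.mk z := by
          rw [← h2]
          exact congrArg (AdicCompletion.transitionMap p.asIdeal _ (Nat.le_add_left 1 n)) hy
        simpa using (Submodule.Quotient.eq _).1 h3
      · rw [AdicCompletion.val_sub_apply, ← hy]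
        rfl
  obtain ⟨⟨n, s⟩, hs⟩ := IsLocalizedModule.surj p.asIdeal.primeCompl
    (LocalizedModule.mkLinearMap p.asIdeal.primeCompl N) z
  have hs' : (s : R) • z = LocalizedModule.mkLinearMap p.asIdeal.primeCompl N n := hs
  refine ⟨s, s.2, n, ?_⟩
  have h4 := Submodule.smul_mem _ (s : R) h1
  rw [smul_sub, ← map_smul, hs'] at h4
  exact h4

theorem exists_smul_sub_mem_of_bpUnit_sub_bpMap_mem [IsNoetherianRing R] (hM : IsColonFlat R M)
    (f : M →ₗ[R] N) (n : N) (v : BP R p M)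
    (h : bpUnit R p N n - bpMap R p f v ∈ p.asIdeal • (⊤ : Submodule R (BP R p N))) :
    ∃ x ∉ p.asIdeal, ∃ m : M, x • n - f m ∈ p.asIdeal • (⊤ : Submodule R N) ∧
      x • v - bpUnit R p M m ∈ p.asIdeal • (⊤ : Submodule R (BP R p M)) := by
  obtain ⟨x, hx, m, hm⟩ := exists_smul_sub_bpUnit_mem p hM v
  have h1 := Submodule.add_mem _ (Submodule.smul_mem _ x h) (map_mem_smul_top (bpMap R p f) hm)
  rw [map_sub, bpMap_bpUnit, map_smul, smul_sub, sub_add_sub_cancel, ← map_smul, ← map_sub] at h1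
  obtain ⟨y, hy, h2⟩ := exists_smul_mem_of_bpUnit_mem p h1
  refine ⟨y * x, fun h => (p.2.mem_or_mem h).elim hy hx, y • m, ?_, ?_⟩
  · rwa [map_smul, mul_smul, ← smul_sub]
  · rw [map_smul, mul_smul, ← smul_sub]
    exact Submodule.smul_mem _ y hm

end BeilinsonParshin

section AdelicComplex

variable (R : Type) [CommRing R]

/-- The functor `A_p` applied to the part of the augmented adelic complex indexed by flags of
primes strictly containing `p`. -/
noncomputable def innerD : (s : ℕ) → (p : PrimeSpectrum R) → (G R s p →ₗ[R] G R (s + 1) p)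
  | 0, p => bpMap R p (psi R p)
  | k + 1, p => bpMap R p
      (phi R k p - LinearMap.pi fun q : {q : PrimeSpectrum R // p < q} =>
        (innerD k q.1) ∘ₗ LinearMap.proj q)

/-- The differential of the part of the augmented adelic complex indexed by flags of primes
strictly containing `p`. -/
noncomputable def aboveD (s : ℕ) (p : PrimeSpectrum R) :
    (∀ q : {q : PrimeSpectrum R // p < q}, G R s q.1) →ₗ[R]
      (∀ q : {q : PrimeSpectrum R // p < q}, G R (s + 1) q.1) :=
  phi R s p - LinearMap.pi fun q : {q : PrimeSpectrum R // p < q} =>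
    (innerD R s q.1) ∘ₗ LinearMap.proj q

/-- The unit of `A_p` with values in the nested adelic module `G (s + 1) p`. -/
noncomputable def unitG (s : ℕ) (p : PrimeSpectrum R) :
    (∀ q : {q : PrimeSpectrum R // p < q}, G R s q.1) →ₗ[R] G R (s + 1) p :=
  bpUnit R p _

/-- The action of `A_p` on maps between products of nested adelic modules. -/
noncomputable def mapG (s t : ℕ) (p : PrimeSpectrum R) :
    ((∀ q : {q : PrimeSpectrum R // p < q}, G R s q.1) →ₗ[R]
      (∀ q : {q : PrimeSpectrum R // p < q}, G R t q.1)) →+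
      (G R (s + 1) p →ₗ[R] G R (t + 1) p) :=
  bpMapAddHom p

variable {R}

theorem innerD_succ (s : ℕ) (p : PrimeSpectrum R) :
    innerD R (s + 1) p = mapG R s (s + 1) p (aboveD R s p) := rfl

theorem ins_zero_succ (s : ℕ) (p : PrimeSpectrum R) :
    ins R 0 (s + 1) p = mapG R s (s + 1) p (phi R s p) := rfl

theorem ins_succ_succ (i s : ℕ) (p : PrimeSpectrum R) :
    ins R (i + 1) (s + 1) p = mapG R s (s + 1) p
      (LinearMap.pi fun q : {q : PrimeSpectrum R // p < q} =>
        (ins R i s q.1) ∘ₗ LinearMap.proj q) := rfl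

theorem innerD_eq_sum_ins (s : ℕ) (p : PrimeSpectrum R) :
    innerD R s p = ∑ i ∈ Finset.range (s + 1), ((-1 : ℤ) ^ i) • ins R i s p := by
  induction s generalizing p with
  | zero =>
    rw [Finset.sum_range_one, pow_zero, one_smul]
    rfl
  | succ s ih =>
    have h : aboveD R s p = (∑ i ∈ Finset.range (s + 1), ((-1 : ℤ) ^ (i + 1)) •
        LinearMap.pi fun q : {q : PrimeSpectrum R // p < q} =>
          (ins R i s q.1) ∘ₗ LinearMap.proj q) + phi R s p := by
      refine LinearMap.ext fun k => funext fun q => ?_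
      simp [aboveD, ih, pow_succ, LinearMap.sum_apply, sub_eq_neg_add]
    rw [Finset.sum_range_succ', innerD_succ, h, map_add, map_sum, pow_zero, one_smul,
      ins_zero_succ]
    refine congrArg (· + _) (Finset.sum_congr rfl fun i _ => ?_)
    rw [map_zsmul, ins_succ_succ]

theorem delta_zero_apply (s : ℕ) (k : ∀ p : PrimeSpectrum R, G R s p) (p : PrimeSpectrum R) :
    delta R s 0 k p = unitG R s p (fun q => k q.1) := by
  rw [delta, if_pos rfl]
  rfl

theorem delta_succ_apply (s i : ℕ) (k : ∀ p : PrimeSpectrum R, G R s p) (p : PrimeSpectrum R) :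
    delta R s (i + 1) k p = ins R i s p (k p) := by
  rw [delta, if_neg i.succ_ne_zero]
  rfl

theorem adelicD_apply (s : ℕ) (k : ∀ p : PrimeSpectrum R, G R s p) (p : PrimeSpectrum R) :
    adelicD R s k p = unitG R s p (fun q => k q.1) - innerD R s p (k p) := by
  have h : adelicD R s k p = ∑ i ∈ Finset.range (s + 2), ((-1 : ℤ) ^ i) • delta R s i k p := by
    rw [adelicD, LinearMap.sum_apply]
    exact Finset.sum_apply p _ _
  have h' : innerD R s p (k p) =
      ∑ i ∈ Finset.range (s + 1), ((-1 : ℤ) ^ i) • ins R i s p (k p) := by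
    rw [innerD_eq_sum_ins, LinearMap.sum_apply]
    rfl
  rw [h, h', Finset.sum_range_succ', delta_zero_apply, pow_zero, one_smul, sub_eq_neg_add,
    ← Finset.sum_neg_distrib]
  refine congrArg (· + _) (Finset.sum_congr rfl fun i _ => ?_)
  rw [delta_succ_apply, pow_succ, mul_neg_one, neg_smul]

theorem aboveD_apply (s : ℕ) (p : PrimeSpectrum R)
    (k : ∀ q : {q : PrimeSpectrum R // p < q}, G R s q.1) (q : {q : PrimeSpectrum R // p < q}) :
    aboveD R s p k q =
      unitG R s q.1 (fun r => k ⟨r.1, q.2.trans r.2⟩) - innerD R s q.1 (k q) :=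
  rfl

theorem innerD_adelicAug (p : PrimeSpectrum R) (r : R) :
    innerD R 0 p (adelicAug R r p) = unitG R 0 p (psi R p r) :=
  bpMap_bpUnit p _ r

theorem innerD_unitG (s : ℕ) (p : PrimeSpectrum R)
    (k : ∀ q : {q : PrimeSpectrum R // p < q}, G R s q.1) :
    innerD R (s + 1) p (unitG R s p k) = unitG R (s + 1) p (aboveD R s p k) :=
  bpMap_bpUnit p _ k

theorem aboveD_psi (p : PrimeSpectrum R) : aboveD R 0 p ∘ₗ psi R p = 0 :=
  LinearMap.ext fun r => funext fun q => sub_eq_zero.2 (innerD_adelicAug q.1 r).symm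

theorem aboveD_comp_aboveD_of_innerD (s : ℕ)
    (h : ∀ p : PrimeSpectrum R, innerD R (s + 1) p ∘ₗ innerD R s p = 0) (p : PrimeSpectrum R) :
    aboveD R (s + 1) p ∘ₗ aboveD R s p = 0 := by
  refine LinearMap.ext fun k => funext fun q => ?_
  rw [LinearMap.comp_apply, aboveD_apply, aboveD_apply, map_sub, innerD_unitG,
    ← LinearMap.comp_apply (f := innerD R (s + 1) q.1), h, LinearMap.zero_apply, sub_zero]
  exact sub_self _

theorem innerD_comp_innerD (s : ℕ) (p : PrimeSpectrum R) :
    innerD R (s + 1) p ∘ₗ innerD R s p = 0 := by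
  induction s generalizing p with
  | zero =>
    have h : innerD R 1 p ∘ₗ innerD R 0 p = bpMap R p (aboveD R 0 p ∘ₗ psi R p) :=
      (bpMap_comp p _ _).symm
    rw [h, aboveD_psi]
    exact bpMap_zero p
  | succ s ih =>
    have h : innerD R (s + 2) p ∘ₗ innerD R (s + 1) p =
        mapG R s (s + 2) p (aboveD R (s + 1) p ∘ₗ aboveD R s p) :=
      (bpMap_comp p _ _).symm
    rw [h, aboveD_comp_aboveD_of_innerD s ih, map_zero]

theorem adelicD_adelicAug (r : R) : adelicD R 0 (adelicAug R r) = 0 := by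
  funext p
  rw [adelicD_apply]
  exact sub_eq_zero.2 (innerD_adelicAug p r).symm

theorem adelicD_adelicD (s : ℕ) (k : ∀ p : PrimeSpectrum R, G R s p) :
    adelicD R (s + 1) (adelicD R s k) = 0 := by
  funext p
  rw [adelicD_apply, adelicD_apply, map_sub, innerD_unitG,
    ← LinearMap.comp_apply (f := innerD R (s + 1) p), innerD_comp_innerD, LinearMap.zero_apply,
    sub_zero]
  have : (fun q : {q : PrimeSpectrum R // p < q} => adelicD R s k q.1) =
      aboveD R s p fun q => k q.1 := funext fun q => adelicD_apply s k q.1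
  rw [this]
  exact sub_self _

theorem isColonFlat_G [IsNoetherianRing R] (s : ℕ) (p : PrimeSpectrum R) :
    IsColonFlat R (G R s p) := by
  induction s generalizing p with
  | zero => exact isColonFlat_self.bp p
  | succ s ih => exact (isColonFlat_pi fun q : {q : PrimeSpectrum R // p < q} => ih q.1).bp p

theorem mem_smul_top_G_of_not_le (s : ℕ) (p : PrimeSpectrum R) (P : Ideal R)
    (hP : ¬ P ≤ p.asIdeal) (v : G R s p) : v ∈ P • (⊤ : Submodule R (G R s p)) := by
  cases s <;> exact mem_smul_top_bp_of_not_le p P hP v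

/-- Membership in `P C^s` only has to be checked on flags starting at or above `P`. -/
theorem mem_smul_top_of_above [IsNoetherianRing R] (s : ℕ) (P : PrimeSpectrum R)
    (v : ∀ p : PrimeSpectrum R, G R s p)
    (hv : v P ∈ P.asIdeal • (⊤ : Submodule R (G R s P)))
    (hv' : (fun q : {q : PrimeSpectrum R // P < q} => v q.1) ∈
      P.asIdeal • (⊤ : Submodule R (∀ q : {q : PrimeSpectrum R // P < q}, G R s q.1))) :
    v ∈ P.asIdeal • (⊤ : Submodule R (∀ p : PrimeSpectrum R, G R s p)) := by
  refine mem_smul_top_pi _ _ fun p => ?_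
  by_cases h : P ≤ p
  · obtain rfl | h := h.eq_or_lt
    · exact hv
    · exact map_mem_smul_top (LinearMap.proj (⟨p, h⟩ : {q : PrimeSpectrum R // P < q})) hv'
  · exact mem_smul_top_G_of_not_le s p _ h _

theorem exists_smul_mem_of_adelicAug_mem (P : PrimeSpectrum R) (r : R)
    (hr : adelicAug R r ∈ P.asIdeal • (⊤ : Submodule R (∀ p : PrimeSpectrum R, G R 0 p))) :
    ∃ x ∉ P.asIdeal, x • r ∈ P.asIdeal • (⊤ : Submodule R R) :=
  exists_smul_mem_of_bpUnit_mem P (map_mem_smul_top (LinearMap.proj P) hr)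

theorem exists_smul_sub_adelicAug_mem [IsNoetherianRing R] (P : PrimeSpectrum R)
    (k : ∀ p : PrimeSpectrum R, G R 0 p)
    (hk : adelicD R 0 k ∈ P.asIdeal • (⊤ : Submodule R (∀ p : PrimeSpectrum R, G R 1 p))) :
    ∃ x ∉ P.asIdeal, ∃ r : R, x • k - adelicAug R r ∈
      P.asIdeal • (⊤ : Submodule R (∀ p : PrimeSpectrum R, G R 0 p)) := by
  have h := map_mem_smul_top (LinearMap.proj P) hk
  rw [LinearMap.proj_apply, adelicD_apply] at h
  obtain ⟨x, hx, r, h₁, h₂⟩ :=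
    exists_smul_sub_mem_of_bpUnit_sub_bpMap_mem P isColonFlat_self (psi R P) _ (k P) h
  exact ⟨x, hx, r, mem_smul_top_of_above 0 P _ h₂ h₁⟩

theorem exists_smul_sub_adelicD_mem [IsNoetherianRing R] (P : PrimeSpectrum R) (s : ℕ)
    (k : ∀ p : PrimeSpectrum R, G R (s + 1) p)
    (hk : adelicD R (s + 1) k ∈
      P.asIdeal • (⊤ : Submodule R (∀ p : PrimeSpectrum R, G R (s + 2) p))) :
    ∃ x ∉ P.asIdeal, ∃ k' : ∀ p : PrimeSpectrum R, G R s p, x • k - adelicD R s k' ∈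
      P.asIdeal • (⊤ : Submodule R (∀ p : PrimeSpectrum R, G R (s + 1) p)) := by
  classical
  have h := map_mem_smul_top (LinearMap.proj P) hk
  rw [LinearMap.proj_apply, adelicD_apply] at h
  obtain ⟨x, hx, e, h₁, h₂⟩ := exists_smul_sub_mem_of_bpUnit_sub_bpMap_mem P
    (isColonFlat_pi fun q : {q : PrimeSpectrum R // P < q} => isColonFlat_G s q.1)
    (aboveD R s P) _ (k P) h
  let k' : ∀ p : PrimeSpectrum R, G R s p := fun p => if hp : P < p then e ⟨p, hp⟩ else 0
  have hk'P : k' P = 0 := dif_neg (lt_irrefl P)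
  have hk' : ∀ q : {q : PrimeSpectrum R // P < q}, k' q.1 = e q := fun q => dif_pos q.2
  refine ⟨x, hx, k', mem_smul_top_of_above (s + 1) P _ ?_ ?_⟩
  · have : adelicD R s k' P =
        unitG R s P e := by
      rw [adelicD_apply, hk'P, map_zero, sub_zero]
      exact congrArg _ (funext hk')
    rw [Pi.sub_apply, this]
    exact h₂
  · have : (fun q : {q : PrimeSpectrum R // P < q} => adelicD R s k' q.1) = aboveD R s P e := by
      funext q
      rw [adelicD_apply, aboveD_apply, hk']
      congr 2
      exact funext fun r => hk' ⟨r.1, q.2.trans r.2⟩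
    have h₃ : (fun q : {q : PrimeSpectrum R // P < q} => (x • k - adelicD R s k') q.1) =
        x • (fun q : {q : PrimeSpectrum R // P < q} => k q.1) - aboveD R s P e := by
      rw [← this]
      rfl
    rw [h₃]
    exact h₁

variable (R)

/-- The terms of the augmented adelic complex, with the augmentation in degree `1`. -/
noncomputable def augTerm : ℕ → ModuleCat R
  | 0 => ModuleCat.of R PUnit
  | 1 => ModuleCat.of R R
  | s + 2 => ModuleCat.of R (∀ p : PrimeSpectrum R, G R s p)

/-- The differential of the augmented adelic complex. -/
noncomputable def augD : (s : ℕ) → (augTerm R s →ₗ[R] augTerm R (s + 1))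
  | 0 => 0
  | 1 => adelicAug R
  | s + 2 => adelicD R s

variable {R}

theorem isColonFlat_augTerm [IsNoetherianRing R] : ∀ s, IsColonFlat R (augTerm R s)
  | 0 => fun I x n _ => by
    rw [show n = 0 from Subsingleton.elim (α := PUnit) _ _]
    exact Submodule.zero_mem _
  | 1 => by
    have h : IsColonFlat R R := isColonFlat_self
    exact h
  | s + 2 => isColonFlat_pi fun p => isColonFlat_G s p

theorem augD_augD : ∀ (s : ℕ) (k : augTerm R s), augD R (s + 1) (augD R s k) = 0
  | 0, _ => map_zero _
  | 1, r => adelicD_adelicAug (R := R) r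
  | s + 2, k => adelicD_adelicD s k

theorem exists_smul_sub_augD_mem [IsNoetherianRing R] (P : PrimeSpectrum R) :
    ∀ (s : ℕ) (k : augTerm R (s + 1)),
      augD R (s + 1) k ∈ P.asIdeal • (⊤ : Submodule R (augTerm R (s + 2))) →
      ∃ x ∉ P.asIdeal, ∃ k' : augTerm R s,
        x • k - augD R s k' ∈ P.asIdeal • (⊤ : Submodule R (augTerm R (s + 1)))
  | 0, r, hr => by
    obtain ⟨x, hx, h⟩ := exists_smul_mem_of_adelicAug_mem P r hr
    refine ⟨x, hx, 0, ?_⟩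
    rw [map_zero, sub_zero]
    exact h
  | 1, k, hk => exists_smul_sub_adelicAug_mem P k hk
  | s + 2, k, hk => exists_smul_sub_adelicD_mem P s k hk

theorem exists_augD_eq [IsNoetherianRing R] (s : ℕ) (k : augTerm R (s + 1))
    (hk : augD R (s + 1) k = 0) : ∃ k', augD R s k' = k := by
  obtain ⟨k', h⟩ := exact_mod_ideal_of_torsion_mod_prime (K := fun s => augTerm R s) (augD R)
    augD_augD (inferInstanceAs (Subsingleton PUnit)) isColonFlat_augTerm
    exists_smul_sub_augD_mem ⊥ s k (by rw [hk]; exact Submodule.zero_mem _)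
  rw [Submodule.bot_smul, Submodule.mem_bot, sub_eq_zero] at h
  exact ⟨k', h.symm⟩

end AdelicComplex

/-- for a commutative Noetherian catenary ring `R` of finite Krull
dimension, the Beilinson–Parshin adelic cochain complex (with `A_p N = Λ_p(L_p N)`
and constant coefficients `R`) has `H⁰ ≅ R` via the canonical augmentation and
`Hˢ = 0` for `s > 0`. -/
theorem beilinson_parshin_adelic_cohomology
    (R : Type) [CommRing R] [IsNoetherianRing R]
    (hcat : IsCatenaryOrder (PrimeSpectrum R))
    (r : ℕ) (hdim : ringKrullDim R = r) :
    Function.Injective (adelicAug R) ∧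
    Function.Exact (adelicAug R) (adelicD R 0) ∧
    ∀ s : ℕ, Function.Exact (adelicD R s) (adelicD R (s + 1)) := by
  refine ⟨(injective_iff_map_eq_zero _).2 fun x hx => ?_,
    fun k => ⟨exists_augD_eq 1 k, ?_⟩, fun s k => ⟨exists_augD_eq (s + 2) k, ?_⟩⟩
  · obtain ⟨_, h⟩ := exists_augD_eq 0 x hx
    exact h.symm
  · rintro ⟨x, rfl⟩
    exact adelicD_adelicAug x
  · rintro ⟨x, rfl⟩
    exact adelicD_adelicD s x
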